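/- Let 2 ≤ k ≤ n. There exists a constant θ > 0 depending only on n and k such that for every λ in the closure of the Gårding cone Γ_k with entries ordered λ₁ ≥ λ₂ ≥ ⋯ ≥ λ_n, one has λ₁ · σ_{k-1;1}(λ) ≥ θ · σ_k(λ). -/

import Mathlib

/-- The `m`-th elementary symmetric polynomial of `λ ∈ ℝⁿ`. -/
noncomputable def esymm (n m : ℕ) (lam : Fin n → ℝ) : ℝ :=
  ∑ s ∈ Finset.powersetCard m (Finset.univ : Finset (Fin n)), ∏ i ∈ s, lam i

/-- The Gårding cone `Γ_k`. -/
def GardingCone (n k : ℕ) : Set (Fin n → ℝ) :=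
  {lam | ∀ j, 1 ≤ j → j ≤ k → 0 < esymm n j lam}

/-- `σ_{m;i}(λ)`: the `m`-th elementary symmetric polynomial of `λ` with the entry
`λ_i` replaced by `0`. -/
noncomputable def esymmDel (n m : ℕ) (i : Fin n) (lam : Fin n → ℝ) : ℝ :=
  esymm n m (Function.update lam i 0)

open Polynomial in
/-- The generating polynomial `∏ (1 + λ_i X)` of the elementary symmetric polynomials. -/
noncomputable def esymmGen {ι : Type*} (s : Finset ι) (lam : ι → ℝ) : ℝ[X] :=
  ∏ i ∈ s, (C (lam i) * X + 1)

section RealRooted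

open Polynomial

theorem splits_derivative_real {p : ℝ[X]} (hp : p.Splits) : (derivative p).Splits := by
  rw [splits_iff_card_roots] at hp ⊢
  have h1 := card_roots_le_derivative p
  have h2 := card_roots' (derivative p)
  have h3 := natDegree_derivative_le p
  rcases Nat.eq_zero_or_pos p.natDegree with h0 | h0 <;> omega

theorem splits_iterate_derivative_real {p : ℝ[X]} (hp : p.Splits) (j : ℕ) :
    (derivative^[j] p).Splits := by
  induction j with
  | zero => simpa using hp
  | succ j ih =>
    rw [Function.iterate_succ_apply']
    exact splits_derivative_real ih

/-- Laguerre's inequality at the origin. -/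
theorem laguerre_coeff {p : ℝ[X]} (hp : p.Splits) :
    2 * p.coeff 0 * p.coeff 2 ≤ p.coeff 1 ^ 2 := by
  have key : ∀ m : Multiset ℝ,
      2 * (m.map fun a => X - C a).prod.coeff 0 * (m.map fun a => X - C a).prod.coeff 2
        ≤ (m.map fun a => X - C a).prod.coeff 1 ^ 2 := by
    intro m
    induction m using Multiset.induction with
    | empty => simp [coeff_one]
    | cons a m ih =>
      rw [Multiset.map_cons, Multiset.prod_cons]
      set g := (m.map fun a => X - C a).prod
      have e0 : ((X - C a) * g).coeff 0 = - a * g.coeff 0 := by simp [sub_mul]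
      have e1 : ((X - C a) * g).coeff 1 = g.coeff 0 - a * g.coeff 1 := by
        simp [sub_mul, coeff_X_mul g 0]
      have e2 : ((X - C a) * g).coeff 2 = g.coeff 1 - a * g.coeff 2 := by
        simp [sub_mul, coeff_X_mul g 1]
      rw [e0, e1, e2]
      nlinarith [mul_le_mul_of_nonneg_left ih (sq_nonneg a), sq_nonneg (g.coeff 0)]
  rw [hp.eq_prod_roots]
  simp only [coeff_C_mul]
  nlinarith [mul_le_mul_of_nonneg_left (key p.roots) (sq_nonneg p.leadingCoeff)]

/-- The coefficients of a real-rooted polynomial satisfy Newton's inequality (without the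
binomial normalization). -/
theorem newton_coeff {p : ℝ[X]} (hp : p.Splits) (j : ℕ) :
    p.coeff j * p.coeff (j + 2) ≤ p.coeff (j + 1) ^ 2 := by
  have h := laguerre_coeff (splits_iterate_derivative_real hp j)
  simp only [coeff_iterate_derivative, nsmul_eq_mul] at h
  have d0 : (0 + j).descFactorial j = j.factorial := by
    rw [zero_add, Nat.descFactorial_self]
  have d1 : (1 + j).descFactorial j = (j + 1) * j.factorial := by
    have := Nat.factorial_mul_descFactorial (show j ≤ 1 + j by omega)
    rw [show 1 + j - j = 1 by omega, Nat.factorial_one, one_mul, add_comm 1 j,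
      Nat.factorial_succ] at this
    rw [add_comm 1 j, this]
  have d2 : 2 * (2 + j).descFactorial j = (j + 2) * ((j + 1) * j.factorial) := by
    have := Nat.factorial_mul_descFactorial (show j ≤ 2 + j by omega)
    rw [show 2 + j - j = 2 by omega, Nat.factorial_two, add_comm 2 j,
      Nat.factorial_succ, Nat.factorial_succ] at this
    rw [add_comm 2 j, this]
  have d2' : (2 : ℝ) * ((2 + j).descFactorial j : ℝ)
      = (j + 2) * ((j + 1) * (j.factorial : ℝ)) := by exact_mod_cast d2
  rw [d0, d1] at h
  push_cast at h
  rw [zero_add, add_comm 1 j, add_comm 2 j] at h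
  rw [add_comm 2 j] at d2'
  set a := p.coeff j
  set b := p.coeff (j + 1)
  set c := p.coeff (j + 2)
  have hF : (0 : ℝ) < j.factorial := by exact_mod_cast j.factorial_pos
  have hj : (0 : ℝ) ≤ j := Nat.cast_nonneg j
  set F : ℝ := (j.factorial : ℝ)
  have h' : (F ^ 2 * (j + 1)) * ((j + 2) * (a * c)) ≤ (F ^ 2 * (j + 1)) * ((j + 1) * b ^ 2) := by
    have e : 2 * (F * a) * (((j + 2).descFactorial j : ℝ) * c)
        = (F ^ 2 * (j + 1)) * ((j + 2) * (a * c)) := by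
      linear_combination F * a * c * d2'
    rw [e] at h
    linarith
  have h'' := le_of_mul_le_mul_left h' (by positivity)
  by_contra! hlt
  nlinarith [sq_nonneg b]

/-- Positivity of the first coefficients of `(1 + cX) q` passes to the real-rooted factor `q`. -/
theorem coeff_pos_of_linear_mul {q : ℝ[X]} (hq : q.Splits) (hq0 : q.coeff 0 = 1) (c : ℝ) (k : ℕ)
    (h : ∀ j, 1 ≤ j → j ≤ k → 0 < ((C c * X + 1) * q).coeff j) :
    ∀ j, j < k → 0 < q.coeff j := by
  have e : ∀ j, ((C c * X + 1) * q).coeff (j + 1) = c * q.coeff j + q.coeff (j + 1) := by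
    intro j
    rw [add_mul, one_mul, coeff_add, mul_assoc, coeff_C_mul, coeff_X_mul]
  intro j
  induction j with
  | zero => intro _; rw [hq0]; exact one_pos
  | succ j ih =>
    intro hj
    have ha := ih (by omega)
    have h1 := h (j + 1) (by omega) (by omega)
    have h2 := h (j + 2) (by omega) (by omega)
    rw [e] at h1 h2
    have hN := newton_coeff hq j
    by_contra! hb
    set a := q.coeff j
    set b := q.coeff (j + 1)
    have s1 : 0 ≤ (c * a + b) * (-b) := mul_nonneg h1.le (by linarith)
    have s2 : 0 < a * (c * b + q.coeff (j + 2)) := mul_pos ha h2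
    nlinarith

end RealRooted

section GeneratingPolynomial

open Polynomial

variable {ι : Type*}

theorem esymmGen_splits (s : Finset ι) (lam : ι → ℝ) : (esymmGen s lam).Splits := by
  unfold esymmGen
  refine Splits.prod fun i _ => Splits.of_natDegree_le_one ?_
  exact natDegree_linear_le

theorem esymmGen_coeff_zero (s : Finset ι) (lam : ι → ℝ) : (esymmGen s lam).coeff 0 = 1 := by
  simp [esymmGen, coeff_zero_eq_eval_zero, eval_prod]

theorem esymmGen_coeff (s : Finset ι) (lam : ι → ℝ) (m : ℕ) :
    (esymmGen s lam).coeff m = ∑ t ∈ s.powersetCard m, ∏ i ∈ t, lam i := by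
  rw [esymmGen, Finset.prod_add_one, finsetSum_coeff, Finset.powersetCard_eq_filter,
    Finset.sum_filter]
  refine Finset.sum_congr rfl fun t _ => ?_
  rw [Finset.prod_mul_distrib, Finset.prod_const, ← map_prod, coeff_C_mul_X_pow]
  simp only [eq_comm]

variable [DecidableEq ι]

theorem esymmGen_eq_mul_erase {s : Finset ι} (lam : ι → ℝ) {i : ι} (hi : i ∈ s) :
    esymmGen s lam = (C (lam i) * X + 1) * esymmGen (s.erase i) lam :=
  (Finset.mul_prod_erase s _ hi).symm

theorem esymmGen_coeff_succ {s : Finset ι} (lam : ι → ℝ) {i : ι} (hi : i ∈ s) (m : ℕ) :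
    (esymmGen s lam).coeff (m + 1) =
      lam i * (esymmGen (s.erase i) lam).coeff m + (esymmGen (s.erase i) lam).coeff (m + 1) := by
  rw [esymmGen_eq_mul_erase lam hi, add_mul, one_mul, coeff_add, mul_assoc, coeff_C_mul,
    coeff_X_mul]

theorem sum_mul_esymmGen_erase (s : Finset ι) (lam : ι → ℝ) (m : ℕ) :
    ∑ i ∈ s, lam i * (esymmGen (s.erase i) lam).coeff m
      = (m + 1) * (esymmGen s lam).coeff (m + 1) := by
  have h := congrArg (fun p : ℝ[X] => p.coeff m)
    (derivative_prod_finset (s := s) (f := fun i => C (lam i) * X + 1))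
  simp only [coeff_derivative, finsetSum_coeff] at h
  rw [mul_comm, esymmGen, h]
  refine Finset.sum_congr rfl fun i _ => ?_
  simp only [esymmGen, derivative_add, derivative_C_mul, derivative_X, derivative_one, mul_one,
    add_zero, coeff_mul_C]
  exact mul_comm _ _

theorem sum_esymmGen_erase (s : Finset ι) (lam : ι → ℝ) (m : ℕ) :
    ∑ i ∈ s, (esymmGen (s.erase i) lam).coeff m = (s.card - m) * (esymmGen s lam).coeff m := by
  cases m with
  | zero => simp [esymmGen_coeff_zero]
  | succ m =>
    have h : ∀ i ∈ s, (esymmGen (s.erase i) lam).coeff (m + 1) =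
        (esymmGen s lam).coeff (m + 1) - lam i * (esymmGen (s.erase i) lam).coeff m := by
      intro i hi
      rw [esymmGen_coeff_succ lam hi]
      ring
    rw [Finset.sum_congr rfl h, Finset.sum_sub_distrib, sum_mul_esymmGen_erase]
    simp
    ring

theorem esymmGen_erase_coeff_pos {s : Finset ι} {lam : ι → ℝ} {k : ℕ}
    (h : ∀ j, 1 ≤ j → j ≤ k → 0 < (esymmGen s lam).coeff j) {i : ι} (hi : i ∈ s) :
    ∀ j, j < k → 0 < (esymmGen (s.erase i) lam).coeff j := by
  rw [esymmGen_eq_mul_erase lam hi] at h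
  exact coeff_pos_of_linear_mul (esymmGen_splits _ _) (esymmGen_coeff_zero _ _) _ _ h

/-- In the Gårding cone, `(m+1) σ_{m+1}` is at most `(#s - m) M σ_m` for any upper bound `M` of
the entries. -/
theorem esymmGen_coeff_succ_le {s : Finset ι} {lam : ι → ℝ} {m : ℕ}
    (h : ∀ j, 1 ≤ j → j ≤ m + 1 → 0 < (esymmGen s lam).coeff j) {M : ℝ}
    (hM : ∀ i ∈ s, lam i ≤ M) :
    (m + 1) * (esymmGen s lam).coeff (m + 1) ≤ M * ((s.card - m) * (esymmGen s lam).coeff m) := by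
  rw [← sum_mul_esymmGen_erase, ← sum_esymmGen_erase, Finset.mul_sum]
  exact Finset.sum_le_sum fun i hi => mul_le_mul_of_nonneg_right (hM i hi)
    (esymmGen_erase_coeff_pos h hi m (Nat.lt_succ_self m)).le

end GeneratingPolynomial

theorem esymm_eq_coeff (n m : ℕ) (lam : Fin n → ℝ) :
    esymm n m lam = (esymmGen Finset.univ lam).coeff m :=
  (esymmGen_coeff _ _ _).symm

theorem esymmDel_eq_coeff (n m : ℕ) (i : Fin n) (lam : Fin n → ℝ) :
    esymmDel n m i lam = (esymmGen (Finset.univ.erase i) lam).coeff m := by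
  rw [esymmDel, esymm_eq_coeff, esymmGen_eq_mul_erase _ (Finset.mem_univ i)]
  have h : esymmGen (Finset.univ.erase i) (Function.update lam i 0)
      = esymmGen (Finset.univ.erase i) lam := by
    refine Finset.prod_congr rfl fun j hj => ?_
    rw [Function.update_of_ne (Finset.ne_of_mem_erase hj)]
  simp [h]

theorem continuous_esymm (n m : ℕ) : Continuous (esymm n m) := by
  unfold esymm
  fun_prop

theorem continuous_esymmDel (n m : ℕ) (i : Fin n) : Continuous (esymmDel n m i) :=
  (continuous_esymm n m).comp (continuous_id.update i continuous_const)

theorem esymm_succ_eq (n m : ℕ) (i : Fin n) (lam : Fin n → ℝ) :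
    esymm n (m + 1) lam = lam i * esymmDel n m i lam + esymmDel n (m + 1) i lam := by
  rw [esymm_eq_coeff, esymmDel_eq_coeff, esymmDel_eq_coeff,
    esymmGen_coeff_succ lam (Finset.mem_univ i)]

theorem esymmDel_succ_le_of_mem_gardingCone {n m : ℕ} (i : Fin n) {lam : Fin n → ℝ}
    (h : lam ∈ GardingCone n (m + 1)) (hmn : m + 1 ≤ n) {M : ℝ} (hM : ∀ j, lam j ≤ M) :
    (m + 1) * esymmDel n (m + 1) i lam ≤ M * ((n - 1 - m) * esymmDel n m i lam) := by
  have hpos : ∀ j, 1 ≤ j → j ≤ m + 1 → 0 < (esymmGen Finset.univ lam).coeff j := by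
    intro j h1 h2
    rw [← esymm_eq_coeff]
    exact h j h1 h2
  have hdel := esymmGen_erase_coeff_pos hpos (Finset.mem_univ i)
  rw [esymmDel_eq_coeff, esymmDel_eq_coeff]
  rcases le_or_gt ((esymmGen (Finset.univ.erase i) lam).coeff (m + 1)) 0 with hle | hgt
  · have hM0 : 0 ≤ M := by
      by_contra! hneg
      have h1 := h 1 le_rfl (by omega)
      rw [esymm, Finset.powersetCard_one, Finset.sum_map] at h1
      have : ∑ j, lam j ≤ 0 := Finset.sum_nonpos fun j _ => (hM j).trans hneg.le
      simp at h1
      linarith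
    have hn : (0 : ℝ) ≤ n - 1 - m := by
      have : ((m + 1 : ℕ) : ℝ) ≤ n := by exact_mod_cast hmn
      push_cast at this
      linarith
    exact (mul_nonpos_of_nonneg_of_nonpos (by positivity) hle).trans
      (mul_nonneg hM0 (mul_nonneg hn (hdel m (Nat.lt_succ_self m)).le))
  · have hcone : ∀ j, 1 ≤ j → j ≤ m + 1 →
        0 < (esymmGen (Finset.univ.erase i) lam).coeff j := by
      intro j _ h2
      rcases h2.lt_or_eq with h2 | rfl
      · exact hdel j h2
      · exact hgt
    have := esymmGen_coeff_succ_le hcone fun j _ => hM j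
    rwa [Finset.card_erase_of_mem (Finset.mem_univ i), Finset.card_univ, Fintype.card_fin,
      Nat.cast_sub (by omega), Nat.cast_one] at this

theorem esymmDel_succ_le_of_mem_closure {n m : ℕ} (i : Fin n) {lam : Fin n → ℝ}
    (h : lam ∈ closure (GardingCone n (m + 1))) (hmn : m + 1 ≤ n) (hi : ∀ j, lam j ≤ lam i) :
    (m + 1) * esymmDel n (m + 1) i lam ≤ lam i * ((n - 1 - m) * esymmDel n m i lam) := by
  have hne : (Finset.univ : Finset (Fin n)).Nonempty := ⟨i, Finset.mem_univ i⟩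
  let M : (Fin n → ℝ) → ℝ := fun μ => Finset.univ.sup' hne fun j => μ j
  have hMc : Continuous M :=
    Continuous.finset_sup'_apply hne fun j _ => continuous_apply j
  have hclosed : IsClosed {μ : Fin n → ℝ |
      (m + 1) * esymmDel n (m + 1) i μ ≤ M μ * ((n - 1 - m) * esymmDel n m i μ)} :=
    isClosed_le (continuous_const.mul (continuous_esymmDel n (m + 1) i))
      (hMc.mul (continuous_const.mul (continuous_esymmDel n m i)))
  have hmem : (m + 1) * esymmDel n (m + 1) i lam ≤ M lam * ((n - 1 - m) * esymmDel n m i lam) :=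
    closure_minimal (fun μ hμ => esymmDel_succ_le_of_mem_gardingCone i hμ hmn
      fun j => Finset.le_sup' (fun j => μ j) (Finset.mem_univ j)) hclosed h
  have hMi : M lam = lam i :=
    le_antisymm (Finset.sup'_le _ _ fun j _ => hi j)
      (Finset.le_sup' (fun j => lam j) (Finset.mem_univ i))
  rwa [hMi] at hmem

/-- for `2 ≤ k ≤ n` there is a universal `θ > 0` (depending only on `n, k`)
such that `λ₁ σ_{k-1;1}(λ) ≥ θ σ_k(λ)` for every `λ` in the closure of `Γ_k` whose
entries are ordered decreasingly. -/
theorem stmt5 (n k : ℕ) (hk : 2 ≤ k) (hkn : k ≤ n) :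
    ∃ θ : ℝ, 0 < θ ∧ ∀ lam ∈ closure (GardingCone n k), Antitone lam →
      lam ⟨0, by omega⟩ * esymmDel n (k - 1) ⟨0, by omega⟩ lam ≥ θ * esymm n k lam := by
  obtain ⟨m, rfl⟩ : ∃ m, k = m + 1 := ⟨k - 1, by omega⟩
  have hn : (0 : ℝ) < n := by exact_mod_cast (by omega : 0 < n)
  refine ⟨(m + 1) / n, by positivity, fun lam hlam hanti => ?_⟩
  have h := esymmDel_succ_le_of_mem_closure ⟨0, by omega⟩ hlam hkn
    fun j => hanti (Fin.le_def.2 (Nat.zero_le _))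
  have hs := esymm_succ_eq n m ⟨0, by omega⟩ lam
  rw [Nat.add_sub_cancel, ge_iff_le, div_mul_eq_mul_div, div_le_iff₀ hn, hs]
  linarith
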